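/- arXiv:1207.0555 — 4 statements merged into one kernel-verified Lean document; each statement's English description precedes it below -/
import Mathlib

section
/- Let N ≥ 1 and let B : ℝ → M_{2N}(ℝ) be a continuous function such that B(t) is symmetric for every t ∈ ℝ. Then the set of differentiable functions z : ℝ → ℝ^{2N} satisfying ż(t) = J B(t) z(t) for all t ∈ ℝ and z(t) → 0 as t → +∞ is a real vector space of dimension at most N. In particular, the space of homoclinic solutions of ż = J B(t) z (i.e., those with z(t) → 0 as |t| → ∞) has dimension at most N. -/
open Filter

/-- The standard symplectic matrix `J = [[0, -I_N], [I_N, 0]]` on `ℝ^{2N}`,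
indexed by `Fin N ⊕ Fin N`. -/
noncomputable def Jmat (N : ℕ) : Matrix (Fin N ⊕ Fin N) (Fin N ⊕ Fin N) ℝ :=
  Matrix.fromBlocks 0 (-1) 1 0


lemma Jmat_transpose (N : ℕ) : (Jmat N).transpose = -Jmat N :=
  Matrix.J_transpose (Fin N) ℝ

lemma Jmat_sq (N : ℕ) : Jmat N * Jmat N = -1 := Matrix.J_squared (Fin N) ℝ

/-- The solutions tending to zero at `+∞`. -/
def solSpace (N : ℕ) (B : ℝ → Matrix (Fin N ⊕ Fin N) (Fin N ⊕ Fin N) ℝ) (l : Filter ℝ) :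
    Submodule ℝ (ℝ → (Fin N ⊕ Fin N) → ℝ) where
  carrier := {z | Differentiable ℝ z ∧ (∀ t, deriv z t = (Jmat N * B t).mulVec (z t)) ∧
          Tendsto z l (nhds 0)}
  zero_mem' := by
    refine ⟨differentiable_const 0, fun t => ?_, tendsto_const_nhds⟩
    have : deriv (0 : ℝ → (Fin N ⊕ Fin N) → ℝ) t = 0 := deriv_const t 0
    rw [this]; simp
  add_mem' := by
    rintro z w ⟨hz, hz1, hz2⟩ ⟨hw, hw1, hw2⟩
    refine ⟨hz.add hw, fun t => ?_, by simpa [Pi.add_def] using hz2.add hw2⟩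
    rw [deriv_add (hz t) (hw t), hz1, hw1, Pi.add_apply, Matrix.mulVec_add]
  smul_mem' := by
    rintro c z ⟨hz, hz1, hz2⟩
    refine ⟨hz.const_smul c, fun t => ?_, by simpa [Pi.smul_def] using hz2.const_smul c⟩
    rw [deriv_const_smul c (hz t), hz1, Pi.smul_apply, Matrix.mulVec_smul]

lemma omega_deriv (N : ℕ) (B : ℝ → Matrix (Fin N ⊕ Fin N) (Fin N ⊕ Fin N) ℝ)
    (hBsymm : ∀ t, (B t).IsSymm) (z w : ℝ → (Fin N ⊕ Fin N) → ℝ) (t : ℝ)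
    (hz : HasDerivAt z ((Jmat N * B t).mulVec (z t)) t)
    (hw : HasDerivAt w ((Jmat N * B t).mulVec (w t)) t) :
    HasDerivAt (fun t => z t ⬝ᵥ (Jmat N).mulVec (w t)) 0 t := by
  have hw2 : HasDerivAt (fun t => (Jmat N).mulVec (w t))
      ((Jmat N).mulVec ((Jmat N * B t).mulVec (w t))) t :=
    ((Matrix.toLin' (Jmat N)).toContinuousLinearMap.hasFDerivAt).comp_hasDerivAt t hw
  have h : HasDerivAt (fun t => z t ⬝ᵥ (Jmat N).mulVec (w t))
      (((Jmat N * B t).mulVec (z t)) ⬝ᵥ (Jmat N).mulVec (w t)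
        + z t ⬝ᵥ ((Jmat N).mulVec ((Jmat N * B t).mulVec (w t)))) t := by
    simp only [dotProduct, ← Finset.sum_add_distrib]
    exact HasDerivAt.fun_sum fun i _ =>
      (hasDerivAt_pi.1 hz i).mul (hasDerivAt_pi.1 hw2 i)
  convert h using 1
  have e1 : (Jmat N * B t).mulVec (z t) ⬝ᵥ (Jmat N).mulVec (w t)
      = z t ⬝ᵥ (B t).mulVec (w t) := by
    rw [← Matrix.vecMul_transpose, ← Matrix.dotProduct_mulVec, Matrix.mulVec_mulVec,
      Matrix.transpose_mul, Jmat_transpose, (hBsymm t).eq, Matrix.mul_assoc,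
      Matrix.neg_mul, Jmat_sq, neg_neg, Matrix.mul_one]
  rw [e1, Matrix.mulVec_mulVec, ← Matrix.mul_assoc, Jmat_sq, Matrix.neg_mul, Matrix.one_mul,
    Matrix.neg_mulVec, dotProduct_neg, add_neg_cancel]

lemma omega_zero (N : ℕ) (B : ℝ → Matrix (Fin N ⊕ Fin N) (Fin N ⊕ Fin N) ℝ)
    (hBsymm : ∀ t, (B t).IsSymm) (z w : ℝ → (Fin N ⊕ Fin N) → ℝ)
    (hz : z ∈ solSpace N B atTop) (hw : w ∈ solSpace N B atTop) (t : ℝ) :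
    z t ⬝ᵥ (Jmat N).mulVec (w t) = 0 := by
  obtain ⟨hz, hz1, hz2⟩ := hz
  obtain ⟨hw, hw1, hw2⟩ := hw
  have hd : ∀ t, HasDerivAt (fun t => z t ⬝ᵥ (Jmat N).mulVec (w t)) 0 t := fun t =>
    omega_deriv N B hBsymm z w t (hz1 t ▸ (hz t).hasDerivAt) (hw1 t ▸ (hw t).hasDerivAt)
  have hc : ∀ s, z s ⬝ᵥ (Jmat N).mulVec (w s) = z t ⬝ᵥ (Jmat N).mulVec (w t) := fun s =>
    is_const_of_deriv_eq_zero (fun x => (hd x).differentiableAt) (fun x => (hd x).deriv) s t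
  have hcont : Continuous fun p : ((Fin N ⊕ Fin N) → ℝ) × ((Fin N ⊕ Fin N) → ℝ) =>
      p.1 ⬝ᵥ (Jmat N).mulVec p.2 :=
    continuous_fst.dotProduct (continuous_const.matrix_mulVec continuous_snd)
  have hl := (hcont.tendsto (0, 0)).comp (hz2.prodMk_nhds hw2)
  simp only [Function.comp_def, hc] at hl
  simpa using tendsto_nhds_unique tendsto_const_nhds hl

lemma sol_unique (N : ℕ) (B : ℝ → Matrix (Fin N ⊕ Fin N) (Fin N ⊕ Fin N) ℝ)
    (hBcont : Continuous B) (z : ℝ → (Fin N ⊕ Fin N) → ℝ)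
    (hz : Differentiable ℝ z) (hz1 : ∀ t, deriv z t = (Jmat N * B t).mulVec (z t))
    (h0 : z 0 = 0) : z = 0 := by
  let L : Matrix (Fin N ⊕ Fin N) (Fin N ⊕ Fin N) ℝ →ₗ[ℝ]
      (((Fin N ⊕ Fin N) → ℝ) →L[ℝ] ((Fin N ⊕ Fin N) → ℝ)) :=
    (LinearMap.toContinuousLinearMap (𝕜 := ℝ) (E := (Fin N ⊕ Fin N) → ℝ)
      (F' := (Fin N ⊕ Fin N) → ℝ)).toLinearMap ∘ₗ (Matrix.toLin' (R := ℝ)).toLinearMap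
  have hLc : Continuous L := L.continuous_of_finiteDimensional
  have hA : Continuous fun t => ‖L (Jmat N * B t)‖₊ :=
    (hLc.comp (continuous_const.matrix_mul hBcont)).nnnorm
  funext t
  obtain ⟨K, hK⟩ := (isCompact_Icc (a := -(|t| + 1)) (b := |t| + 1)).bddAbove_image hA.continuousOn
  have := ODE_solution_unique_of_mem_Icc (v := fun s x => (Jmat N * B s).mulVec x)
    (s := fun _ => Set.univ) (K := K) (f := z) (g := 0) (a := -(|t| + 1)) (b := |t| + 1) (t₀ := 0)
    (fun s hs => ((L (Jmat N * B s)).lipschitz.weaken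
      (hK ⟨s, Set.Ioo_subset_Icc_self hs, rfl⟩)).lipschitzOnWith)
    ⟨by linarith [abs_nonneg t], by linarith [abs_nonneg t]⟩
    hz.continuous.continuousOn (fun s _ => hz1 s ▸ (hz s).hasDerivAt) (fun _ _ => trivial)
    continuousOn_const (fun s _ => by
      simpa using hasDerivAt_const s (0 : (Fin N ⊕ Fin N) → ℝ)) (fun _ _ => trivial) h0
  exact this ⟨by linarith [neg_abs_le t], by linarith [le_abs_self t]⟩

lemma rank_solSpace (N : ℕ) (B : ℝ → Matrix (Fin N ⊕ Fin N) (Fin N ⊕ Fin N) ℝ)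
    (hBcont : Continuous B) (hBsymm : ∀ t, (B t).IsSymm) :
    Module.rank ℝ (solSpace N B atTop) ≤ (N : Cardinal) := by
  let E : solSpace N B atTop →ₗ[ℝ] ((Fin N ⊕ Fin N) → ℝ) :=
    (LinearMap.proj (R := ℝ) (φ := fun _ : ℝ => (Fin N ⊕ Fin N) → ℝ) 0) ∘ₗ
      (solSpace N B atTop).subtype
  have hE : Function.Injective E := by
    rw [injective_iff_map_eq_zero]
    rintro ⟨z, hz⟩ h
    exact Subtype.ext (sol_unique N B hBcont z hz.1 hz.2.1 h)
  rw [← rank_range_of_injective E hE, ← Module.finrank_eq_rank, Nat.cast_le]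
  have hJ : Function.Injective (Matrix.toLin' (Jmat N)) := by
    rw [injective_iff_map_eq_zero]
    intro v hv
    have h2 : (Jmat N * Jmat N).mulVec v = 0 := by
      rw [← Matrix.mulVec_mulVec, ← Matrix.toLin'_apply (Jmat N) v, hv, Matrix.mulVec_zero]
    rw [Jmat_sq, Matrix.neg_mulVec, Matrix.one_mulVec] at h2
    simpa using h2
  have hdis : Disjoint (LinearMap.range E)
      ((LinearMap.range E).map (Matrix.toLin' (Jmat N))) := by
    rw [Submodule.disjoint_def]
    rintro _ ⟨⟨z, hz⟩, rfl⟩ ⟨_, ⟨⟨w, hw⟩, rfl⟩, h⟩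
    have h1 := omega_zero N B hBsymm z w hz hw 0
    have h2 : (Jmat N).mulVec (w 0) = z 0 := h
    rw [h2] at h1
    exact dotProduct_self_eq_zero.1 h1
  have h1 := Submodule.finrank_add_finrank_le_of_disjoint hdis
  have h2 := LinearMap.finrank_range_of_inj
    (f := (Matrix.toLin' (Jmat N)) ∘ₗ (LinearMap.range E).subtype)
    (hJ.comp Subtype.val_injective)
  rw [LinearMap.range_comp, Submodule.range_subtype] at h2
  simp only [Module.finrank_fintype_fun_eq_card, Fintype.card_sum, Fintype.card_fin] at h1
  omega

/-- The set of differentiable solutions of the linear Hamiltonian system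
`ż = J B(t) z` tending to `0` as `t → +∞` is a real vector space of dimension
at most `N`; in particular the space of homoclinic solutions (those with
`z(t) → 0` as `|t| → ∞`) has dimension at most `N`. -/
theorem stmt0 (N : ℕ) (hN : 1 ≤ N)
    (B : ℝ → Matrix (Fin N ⊕ Fin N) (Fin N ⊕ Fin N) ℝ)
    (hBcont : Continuous B) (hBsymm : ∀ t, (B t).IsSymm) :
    (∃ S : Submodule ℝ (ℝ → (Fin N ⊕ Fin N) → ℝ),
      (S : Set (ℝ → (Fin N ⊕ Fin N) → ℝ)) =
        {z | Differentiable ℝ z ∧ (∀ t, deriv z t = (Jmat N * B t).mulVec (z t)) ∧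
          Tendsto z atTop (nhds 0)} ∧
      Module.rank ℝ S ≤ (N : Cardinal)) ∧
    (∃ S' : Submodule ℝ (ℝ → (Fin N ⊕ Fin N) → ℝ),
      (S' : Set (ℝ → (Fin N ⊕ Fin N) → ℝ)) =
        {z | Differentiable ℝ z ∧ (∀ t, deriv z t = (Jmat N * B t).mulVec (z t)) ∧
          Tendsto z atTop (nhds 0) ∧ Tendsto z atBot (nhds 0)} ∧
      Module.rank ℝ S' ≤ (N : Cardinal)) := by
  refine ⟨⟨solSpace N B atTop, rfl, rank_solSpace N B hBcont hBsymm⟩,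
    solSpace N B atTop ⊓ solSpace N B atBot, ?_,
    (Submodule.rank_mono inf_le_left).trans (rank_solSpace N B hBcont hBsymm)⟩
  ext z
  constructor
  · rintro ⟨⟨h1, h2, h3⟩, -, -, h4⟩
    exact ⟨h1, h2, h3, h4⟩
  · rintro ⟨h1, h2, h3, h4⟩
    exact ⟨⟨h1, h2, h3⟩, h1, h2, h4⟩
end

section
/- Let N ≥ 1 and let W : ℝ → M_{2N}(ℝ) be a function with W(t) ∈ Sp(2N, ℝ) for every t ∈ ℝ. If z₀ ∈ ℝ^{2N} satisfies W(t) z₀ → 0 and W(t) (J z₀) → 0 as t → +∞, then z₀ = 0. -/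
open Matrix Filter

/-- If `W(t)` is symplectic for every `t` and both `W(t) z₀ → 0` and
`W(t) (J z₀) → 0` as `t → +∞`, then `z₀ = 0`. -/
theorem stmt2 (N : ℕ) (hN : 1 ≤ N)
    (W : ℝ → Matrix (Fin N ⊕ Fin N) (Fin N ⊕ Fin N) ℝ)
    (hW : ∀ t, (W t)ᵀ * Jmat N * W t = Jmat N)
    (z₀ : (Fin N ⊕ Fin N) → ℝ)
    (h₁ : Tendsto (fun t => (W t).mulVec z₀) atTop (nhds 0))
    (h₂ : Tendsto (fun t => (W t).mulVec ((Jmat N).mulVec z₀)) atTop (nhds 0)) :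
    z₀ = 0 := by
  have key : ∀ t, (W t).mulVec z₀ ⬝ᵥ
      (Jmat N).mulVec ((W t).mulVec ((Jmat N).mulVec z₀)) = -(z₀ ⬝ᵥ z₀) := by
    intro t
    have hJ : Jmat N * Jmat N = -1 := Matrix.J_squared (Fin N) ℝ
    have e : (W t).mulVec z₀ = Matrix.vecMul z₀ (W t)ᵀ := (Matrix.vecMul_transpose _ _).symm
    rw [e, ← Matrix.dotProduct_mulVec, Matrix.mulVec_mulVec, Matrix.mulVec_mulVec,
      Matrix.mulVec_mulVec, hW t, hJ,
      Matrix.neg_mulVec, Matrix.one_mulVec, dotProduct_neg]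
  have hc : Continuous (fun p : ((Fin N ⊕ Fin N) → ℝ) × ((Fin N ⊕ Fin N) → ℝ) =>
      p.1 ⬝ᵥ (Jmat N).mulVec p.2) := by
    fun_prop
  have hl := (hc.tendsto (0, 0)).comp (h₁.prodMk_nhds h₂)
  have hl' : Tendsto (fun _ : ℝ => -(z₀ ⬝ᵥ z₀)) atTop (nhds 0) := by
    refine (hl.congr key).trans ?_
    simp
  have h0 := tendsto_nhds_unique tendsto_const_nhds hl'
  exact dotProduct_self_eq_zero.mp (neg_eq_zero.mp h0)
end

section
/- Let N ≥ 1, c > 0, R₀ > 0. Let R : ℝ × ℝ^{2N} → ℝ be C² with ∇_z R(t, 0) = 0 for all t and ‖∇²_z R(t, z)‖ ≤ c for all (t, z) (operator norm of the Hessian in z). Let B_∞ : ℝ → M_{2N}(ℝ) be continuous, symmetric-valued and uniformly bounded, and suppose ∇²_z R(t, z) ≥ B_∞(t) (Loewner order) whenever |z| > R₀. Then there exist γ ∈ ℝ such that γ I_{2N} − B_∞(t) is positive definite for all t, a strictly increasing sequence of real numbers M_k > R₀ with M_k → ∞, C² functions R_k : ℝ × ℝ^{2N} → ℝ, a constant C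 > 0 independent of k, and constants C_k > 0, such that for every k: (1) R_k(t, z) = R(t, z) whenever |z| ≤ M_k; (2) ‖∇²_z R_k(t, z)‖ ≤ C for all (t, z) and ∇²_z R_k(t, z) ≥ B_∞(t) whenever |z| ≥ R₀; (3) |∇_z R_k(t, z) − γ z| ≤ C_k for all (t, z). -/
open Filter Function

/-- The continuous linear map on `EuclideanSpace ℝ n` associated with a matrix. -/
noncomputable def matCLM {n : Type*} [Fintype n] [DecidableEq n] (A : Matrix n n ℝ) :
    EuclideanSpace ℝ n →L[ℝ] EuclideanSpace ℝ n :=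
  LinearMap.toContinuousLinearMap (Matrix.toEuclideanLin A)


section helpers

set_option linter.unusedSectionVars false

variable {E : Type*} [NormedAddCommGroup E] [InnerProductSpace ℝ E] [FiniteDimensional ℝ E]

lemma fderiv_contDiff_one {F : E → ℝ} (hF : ContDiff ℝ 2 F) : ContDiff ℝ 1 (fderiv ℝ F) :=
  hF.fderiv_right (by norm_num)

lemma exists_cutoff : ∃ K : ℝ, 0 ≤ K ∧ ∀ M : ℝ, 0 < M → ∃ χ : E → ℝ, ContDiff ℝ 2 χ ∧
    (∀ z, 0 ≤ χ z) ∧ (∀ z, χ z ≤ 1) ∧ (∀ z, ‖z‖ ≤ 2 * M → χ z = 1) ∧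
    (∀ z, 4 * M ≤ ‖z‖ → χ z = 0) ∧ (∀ z, ‖fderiv ℝ χ z‖ ≤ K / M) ∧
    (∀ z, ‖fderiv ℝ (fderiv ℝ χ) z‖ ≤ K / M ^ 2) := by
  let b : ContDiffBump (0 : E) := ⟨2, 4, by norm_num, by norm_num⟩
  have hb : ContDiff ℝ 2 b := b.contDiff
  have hb1 := fderiv_contDiff_one hb
  obtain ⟨K1, hK1⟩ := (hb1.continuous).bounded_above_of_compact_support
    (b.hasCompactSupport.fderiv (𝕜 := ℝ))
  obtain ⟨K2, hK2⟩ := (hb1.continuous_fderiv (by norm_num)).bounded_above_of_compact_support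
    ((b.hasCompactSupport.fderiv (𝕜 := ℝ)).fderiv (𝕜 := ℝ))
  have hK1p : 0 ≤ K1 := (norm_nonneg _).trans (hK1 0)
  refine ⟨max K1 K2, le_max_of_le_left hK1p, fun M hM => ?_⟩
  have e1 : fderiv ℝ (fun z : E => b (M⁻¹ • z)) = fun z => M⁻¹ • fderiv ℝ b (M⁻¹ • z) := by
    ext1 z; rw [fderiv_comp_smul]
  have nrm : ∀ z : E, ‖M⁻¹ • z‖ = ‖z‖ / M := fun z => by
    rw [norm_smul, Real.norm_eq_abs, abs_of_pos (inv_pos.2 hM)]; ring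
  refine ⟨fun z => b (M⁻¹ • z), hb.comp (contDiff_const_smul _), fun z => b.nonneg,
    fun z => b.le_one, fun z hz => ?_, fun z hz => ?_, fun z => ?_, fun z => ?_⟩
  · apply b.one_of_mem_closedBall
    rw [mem_closedBall_zero_iff, nrm, div_le_iff₀ hM]
    exact hz
  · apply b.zero_of_le_dist
    rw [dist_zero_right, nrm, le_div_iff₀ hM]
    exact hz
  · rw [e1, norm_smul, Real.norm_eq_abs, abs_of_pos (inv_pos.2 hM), div_eq_inv_mul]
    gcongr
    exact (hK1 _).trans (le_max_left _ _)
  · have e2 : fderiv ℝ (fun z : E => M⁻¹ • fderiv ℝ b (M⁻¹ • z)) z =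
        M⁻¹ • M⁻¹ • fderiv ℝ (fderiv ℝ b) (M⁻¹ • z) := by
      rw [← fderiv_comp_smul]
      exact fderiv_fun_const_smul
        (((hb1.differentiable (by norm_num)).comp (differentiable_id.const_smul M⁻¹)) z) M⁻¹
    rw [e1, e2, smul_smul]
    refine (ContinuousLinearMap.opNorm_smul_le _ _).trans ?_
    rw [Real.norm_of_nonneg (by positivity), div_eq_inv_mul, ← sq, inv_pow]
    gcongr
    exact (hK2 _).trans (le_max_right _ _)

lemma exists_convex : ∃ U : ℝ, 0 ≤ U ∧ ∀ M : ℝ, 0 < M → ∃ h : E → ℝ, ContDiff ℝ 2 h ∧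
    (∀ z, ‖z‖ ≤ M → h z = 0) ∧ (∀ z, ‖fderiv ℝ h z‖ ≤ ‖z‖) ∧
    (∀ z, 2 * M ≤ ‖z‖ → fderiv ℝ h z = innerSL ℝ z) ∧
    (∀ z v, 0 ≤ fderiv ℝ (fderiv ℝ h) z v v) ∧
    (∀ z v, 2 * M ≤ ‖z‖ → ‖v‖ ^ 2 ≤ fderiv ℝ (fderiv ℝ h) z v v) ∧
    (∀ z, ‖fderiv ℝ (fderiv ℝ h) z‖ ≤ U) := by
  let u : ℝ → ℝ := fun s => Real.smoothTransition (s - 1)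
  have hu : ContDiff ℝ 1 u := Real.smoothTransition.contDiff.comp (contDiff_id.sub contDiff_const)
  have hud : ∀ s, HasDerivAt u (deriv u s) s := fun s =>
    (hu.differentiable (by norm_num) s).hasDerivAt
  have hu0 : ∀ s, 0 ≤ u s := fun s => Real.smoothTransition.nonneg _
  have hu1 : ∀ s, u s ≤ 1 := fun s => Real.smoothTransition.le_one _
  have hus : ∀ s, s ≤ 1 → u s = 0 := fun s hs =>
    Real.smoothTransition.zero_of_nonpos (by linarith)
  have hub : ∀ s, 2 ≤ s → u s = 1 := fun s hs =>
    Real.smoothTransition.one_of_one_le (by linarith)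
  have hmono : Monotone u := fun a b hab => Real.smoothTransition.monotone (by linarith)
  have hdunonneg : ∀ s, 0 ≤ deriv u s := fun s => hmono.deriv_nonneg
  have hducont : Continuous (deriv u) := hu.continuous_deriv (by norm_num)
  obtain ⟨U, hU⟩ := (isCompact_Icc (a := (0:ℝ)) (b := 2)).exists_bound_of_continuousOn
    hducont.continuousOn
  have hUp : 0 ≤ U := (norm_nonneg _).trans (hU 0 (by simp))
  have hdubd : ∀ s, 0 ≤ s → s * deriv u s ≤ 2 * U := by
    intro s hs
    by_cases h2 : s ≤ 2
    · have := hU s ⟨hs, h2⟩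
      rw [Real.norm_eq_abs, abs_of_nonneg (hdunonneg s)] at this
      exact mul_le_mul h2 this (hdunonneg s) (by norm_num)
    · push Not at h2
      have : u =ᶠ[nhds s] fun _ => (1:ℝ) := by
        filter_upwards [lt_mem_nhds h2] with x hx using hub x hx.le
      rw [this.deriv_eq]; simp; exact hUp
  let g : ℝ → ℝ := fun s => ∫ x in (0:ℝ)..s, u x
  have hg : ∀ s, HasDerivAt g (u s) s := fun s =>
    intervalIntegral.integral_hasDerivAt_right (hu.continuous.intervalIntegrable _ _)
      hu.continuous.stronglyMeasurable.stronglyMeasurableAtFilter hu.continuous.continuousAt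
  have hg2 : ContDiff ℝ 2 g := by
    have : (2 : WithTop ℕ∞) = 1 + 1 := by norm_num
    rw [this, contDiff_succ_iff_deriv]
    refine ⟨fun s => (hg s).differentiableAt, by simp, ?_⟩
    have : deriv g = u := funext fun s => (hg s).deriv
    rw [this]; exact hu
  have hg0 : ∀ s, 0 ≤ s → s ≤ 1 → g s = 0 := by
    intro s h0 h1
    have : ∀ x ∈ Set.uIcc 0 s, u x = 0 := fun x hx => by
      rw [Set.uIcc_of_le h0] at hx
      exact hus x (hx.2.trans h1)
    show (∫ x in (0:ℝ)..s, u x) = 0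
    rw [intervalIntegral.integral_congr (g := fun _ => 0) this]; simp
  refine ⟨1 + 4 * U, by positivity, fun M hM => ?_⟩
  have hM2 : 0 < M ^ 2 := by positivity
  let q : E → ℝ := fun z => ‖z‖ ^ 2 / M ^ 2
  have hq0 : ∀ z, 0 ≤ q z := fun z => by positivity
  have hqb : ∀ z, 2 * M ≤ ‖z‖ → 2 ≤ q z := fun z hz => by
    show 2 ≤ ‖z‖ ^ 2 / M ^ 2
    rw [le_div_iff₀ hM2]; nlinarith
  have hq : ∀ z, HasFDerivAt q ((2 / M ^ 2) • innerSL ℝ z) z := fun z => by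
    have := (hasStrictFDerivAt_norm_sq z).hasFDerivAt.const_smul (M ^ 2)⁻¹
    refine (this.congr_fderiv ?_).congr_of_eventuallyEq ?_
    · ext v; simp; ring
    · filter_upwards with x
      simp [q]; ring
  let h : E → ℝ := fun z => (M ^ 2 / 2) * g (q z)
  have hh1 : ∀ z, HasFDerivAt h (u (q z) • innerSL ℝ z) z := fun z => by
    have := ((hg (q z)).comp_hasFDerivAt z (hq z)).const_mul (M ^ 2 / 2)
    refine this.congr_fderiv ?_
    ext v; simp; field_simp
  have hf1 : fderiv ℝ h = fun z => u (q z) • innerSL ℝ z := funext fun z => (hh1 z).fderiv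
  let J : E →L[ℝ] E →L[ℝ] ℝ := innerSL ℝ
  have hh2 : ∀ z, HasFDerivAt (fun z : E => u (q z) • innerSL ℝ z)
      (u (q z) • J +
        (deriv u (q z) • (2 / M ^ 2) • innerSL ℝ z).smulRight (innerSL ℝ z)) z := fun z => by
    have h1 := (hud (q z)).comp_hasFDerivAt z (hq z)
    exact h1.smul J.hasFDerivAt
  have hval : ∀ z v w, fderiv ℝ (fderiv ℝ h) z v w =
      u (q z) * inner ℝ v w + deriv u (q z) * (2 / M ^ 2) * inner ℝ z v * inner ℝ z w := by
    intro z v w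
    rw [hf1, (hh2 z).fderiv]
    have hJ : J v w = inner ℝ v w := rfl
    simp only [add_apply, smul_apply,
      ContinuousLinearMap.smulRight_apply, smul_eq_mul, innerSL_apply_apply, hJ]
    ring
  have hge : ∀ z v, u (q z) * ‖v‖ ^ 2 ≤ fderiv ℝ (fderiv ℝ h) z v v := by
    intro z v
    rw [hval, real_inner_self_eq_norm_sq, mul_assoc (deriv u (q z) * (2 / M ^ 2))]
    have := mul_nonneg (mul_nonneg (hdunonneg (q z)) (by positivity : 0 ≤ 2 / M ^ 2))
      (mul_self_nonneg (inner ℝ z v))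
    linarith
  refine ⟨h, ?_, fun z hz => ?_, fun z => ?_, fun z hz => ?_, fun z v => ?_, fun z v hz => ?_,
    fun z => ?_⟩
  · exact contDiff_const.mul (hg2.comp ((contDiff_norm_sq ℝ).div_const _))
  · have : g (q z) = 0 := hg0 _ (hq0 z) (by
      show ‖z‖ ^ 2 / M ^ 2 ≤ 1
      rw [div_le_one hM2]; gcongr)
    show _ * g (q z) = 0
    rw [this, mul_zero]
  · rw [hf1]
    show ‖u (q z) • innerSL ℝ z‖ ≤ _
    rw [norm_smul, Real.norm_eq_abs, abs_of_nonneg (hu0 _), innerSL_apply_norm]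
    exact mul_le_of_le_one_left (norm_nonneg _) (hu1 _)
  · rw [hf1]
    show u (q z) • innerSL ℝ z = _
    rw [hub _ (hqb z hz), one_smul]
  · exact (mul_nonneg (hu0 _) (sq_nonneg _)).trans (hge z v)
  · have := hge z v
    rwa [hub _ (hqb z hz), one_mul] at this
  · refine ContinuousLinearMap.opNorm_le_bound₂ _ (by positivity) fun v w => ?_
    rw [hval]
    refine (norm_add_le _ _).trans ?_
    rw [norm_mul, norm_mul, norm_mul, Real.norm_of_nonneg (hu0 _),
      Real.norm_of_nonneg (mul_nonneg (hdunonneg (q z)) (by positivity : 0 ≤ 2 / M ^ 2))]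
    have a1 := norm_inner_le_norm (𝕜 := ℝ) v w
    have a2 := norm_inner_le_norm (𝕜 := ℝ) z v
    have a3 := norm_inner_le_norm (𝕜 := ℝ) z w
    have hp : 0 ≤ deriv u (q z) * (2 / M ^ 2) := mul_nonneg (hdunonneg _) (by positivity)
    calc _ ≤ 1 * (‖v‖ * ‖w‖) + deriv u (q z) * (2 / M ^ 2) * (‖z‖ * ‖v‖) * (‖z‖ * ‖w‖) := by
          gcongr
          exact hu1 _
      _ = (1 + 2 * (q z * deriv u (q z))) * ‖v‖ * ‖w‖ := by
          simp only [q]; ring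
      _ ≤ (1 + 4 * U) * ‖v‖ * ‖w‖ := by
          gcongr ?_ * ‖v‖ * ‖w‖
          linarith [hdubd _ (hq0 z)]

/-- Second derivative of `χ f + γ h`. -/
lemma snd_deriv_formula {χ f h : E → ℝ} (hχ : ContDiff ℝ 2 χ) (hf : ContDiff ℝ 2 f)
    (hh : ContDiff ℝ 2 h) (a γ : ℝ) :
    (∀ z, fderiv ℝ (fun z => a + χ z * f z + γ * h z) z =
      χ z • fderiv ℝ f z + f z • fderiv ℝ χ z + γ • fderiv ℝ h z) ∧
    (∀ z v w, fderiv ℝ (fderiv ℝ (fun z => a + χ z * f z + γ * h z)) z v w =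
      χ z * fderiv ℝ (fderiv ℝ f) z v w + fderiv ℝ χ z v * fderiv ℝ f z w +
      fderiv ℝ f z v * fderiv ℝ χ z w + f z * fderiv ℝ (fderiv ℝ χ) z v w +
      γ * fderiv ℝ (fderiv ℝ h) z v w) := by
  have d : ∀ {g : E → ℝ}, ContDiff ℝ 2 g → ∀ z, HasFDerivAt g (fderiv ℝ g z) z := fun hg z =>
    (hg.differentiable (by norm_num) z).hasFDerivAt
  have d2 : ∀ {g : E → ℝ}, ContDiff ℝ 2 g → ∀ z,
      HasFDerivAt (fderiv ℝ g) (fderiv ℝ (fderiv ℝ g) z) z := fun hg z =>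
    ((fderiv_contDiff_one hg).differentiable (by norm_num) z).hasFDerivAt
  have e1 : ∀ z, fderiv ℝ (fun z => a + χ z * f z + γ * h z) z =
      χ z • fderiv ℝ f z + f z • fderiv ℝ χ z + γ • fderiv ℝ h z := fun z =>
    ((((d hχ z).mul (d hf z)).const_add a).add ((d hh z).const_mul γ)).fderiv
  refine ⟨e1, fun z v w => ?_⟩
  have e2 : HasFDerivAt (fun z => χ z • fderiv ℝ f z + f z • fderiv ℝ χ z + γ • fderiv ℝ h z) _ z :=
    ((((d hχ z).smul (d2 hf z)).add ((d hf z).smul (d2 hχ z))).add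
    ((d2 hh z).const_smul γ))
  rw [funext e1, e2.fderiv]
  simp
  ring


lemma growth_bounds {f : E → ℝ} (hf : ContDiff ℝ 2 f) {c : ℝ} (hf0 : f 0 = 0)
    (hdf0 : fderiv ℝ f 0 = 0) (hb : ∀ z, ‖fderiv ℝ (fderiv ℝ f) z‖ ≤ c) :
    (∀ z, ‖fderiv ℝ f z‖ ≤ c * ‖z‖) ∧ (∀ z, ‖f z‖ ≤ c * ‖z‖ ^ 2) := by
  have hc : 0 ≤ c := (ContinuousLinearMap.opNorm_nonneg _).trans (hb 0)
  have h1 : ∀ z, ‖fderiv ℝ f z‖ ≤ c * ‖z‖ := fun z => by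
    have := Convex.norm_image_sub_le_of_norm_fderiv_le (𝕜 := ℝ) (f := fderiv ℝ f) (C := c)
      (s := Set.univ) (x := 0) (y := z)
      (fun x _ => (fderiv_contDiff_one hf).differentiable (by norm_num) x)
      (fun x _ => hb x) convex_univ trivial trivial
    simpa [hdf0] using this
  refine ⟨h1, fun z => ?_⟩
  have := Convex.norm_image_sub_le_of_norm_fderiv_le (𝕜 := ℝ) (f := f) (C := c * ‖z‖)
      (s := Metric.closedBall 0 ‖z‖) (x := 0) (y := z)
      (fun x _ => hf.differentiable (by norm_num) x)
      (fun x hx => (h1 x).trans (by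
        rw [mem_closedBall_zero_iff] at hx; gcongr)) (convex_closedBall _ _) (by simp) (by simp)
  rw [hf0, sub_zero, sub_zero] at this
  linarith

lemma fderiv_fderiv_congr {f g : E → ℝ} {z : E} (h : f =ᶠ[nhds z] g) :
    fderiv ℝ f z = fderiv ℝ g z ∧ fderiv ℝ (fderiv ℝ f) z = fderiv ℝ (fderiv ℝ g) z :=
  ⟨h.fderiv_eq, h.fderiv.fderiv_eq⟩

lemma core {χ f h : E → ℝ} (hχ : ContDiff ℝ 2 χ) (hf : ContDiff ℝ 2 f)
    (hh : ContDiff ℝ 2 h) (a γ : ℝ) (hγ : 0 ≤ γ) {c K U M : ℝ} (hM : 0 < M) (hK : 0 ≤ K)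
    (hf0 : f 0 = 0)
    (hdf0 : fderiv ℝ f 0 = 0) (hb : ∀ z, ‖fderiv ℝ (fderiv ℝ f) z‖ ≤ c)
    (hχ0 : ∀ z, 0 ≤ χ z) (hχ1 : ∀ z, χ z ≤ 1) (hχi : ∀ z, ‖z‖ ≤ 2 * M → χ z = 1)
    (hχo : ∀ z, 4 * M ≤ ‖z‖ → χ z = 0) (hχd : ∀ z, ‖fderiv ℝ χ z‖ ≤ K / M)
    (hχdd : ∀ z, ‖fderiv ℝ (fderiv ℝ χ) z‖ ≤ K / M ^ 2)
    (hhd : ∀ z, ‖fderiv ℝ h z‖ ≤ ‖z‖)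
    (hho : ∀ z, 2 * M ≤ ‖z‖ → fderiv ℝ h z = innerSL ℝ z)
    (hh0 : ∀ z v, 0 ≤ fderiv ℝ (fderiv ℝ h) z v v)
    (hh2 : ∀ z v, 2 * M ≤ ‖z‖ → ‖v‖ ^ 2 ≤ fderiv ℝ (fderiv ℝ h) z v v)
    (hhU : ∀ z, ‖fderiv ℝ (fderiv ℝ h) z‖ ≤ U) :
    let F : E → ℝ := fun z => a + χ z * f z + γ * h z
    (∀ z, ‖fderiv ℝ (fderiv ℝ F) z‖ ≤ c + 24 * c * K + γ * U) ∧
    (∀ z, ‖fderiv ℝ F z - γ • innerSL ℝ z‖ ≤ 4 * c * M + 16 * c * K * M + 8 * γ * M) ∧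
    (∀ z v, ‖z‖ < 2 * M → fderiv ℝ (fderiv ℝ f) z v v ≤ fderiv ℝ (fderiv ℝ F) z v v) ∧
    (∀ z v, 2 * M ≤ ‖z‖ → (γ - c - 24 * c * K) * ‖v‖ ^ 2 ≤ fderiv ℝ (fderiv ℝ F) z v v) := by
  intro F
  have hc : 0 ≤ c := (ContinuousLinearMap.opNorm_nonneg _).trans (hb 0)
  obtain ⟨g1, g2⟩ := growth_bounds hf hf0 hdf0 hb
  obtain ⟨e1, e2⟩ := snd_deriv_formula hχ hf hh a γ
  have hout : ∀ z, 4 * M < ‖z‖ → fderiv ℝ χ z = 0 ∧ fderiv ℝ (fderiv ℝ χ) z = 0 := by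
    intro z hz
    have : χ =ᶠ[nhds z] fun _ => (0:ℝ) := by
      filter_upwards [continuous_norm.continuousAt.eventually (lt_mem_nhds hz)] with x hx
        using hχo x (le_of_lt hx)
    obtain ⟨h1, h2⟩ := fderiv_fderiv_congr this
    rw [h1, h2]
    simp
  have hin : ∀ z, ‖z‖ < 2 * M → fderiv ℝ χ z = 0 ∧ fderiv ℝ (fderiv ℝ χ) z = 0 := by
    intro z hz
    have : χ =ᶠ[nhds z] fun _ => (1:ℝ) := by
      filter_upwards [continuous_norm.continuousAt.eventually (gt_mem_nhds hz)] with x hx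
        using hχi x (le_of_lt hx)
    obtain ⟨h1, h2⟩ := fderiv_fderiv_congr this
    rw [h1, h2]
    simp
  have b1 : ∀ z, ‖fderiv ℝ χ z‖ * ‖fderiv ℝ f z‖ ≤ 4 * c * K := by
    intro z
    by_cases hz : 4 * M < ‖z‖
    · rw [(hout z hz).1]; simp; positivity
    · push Not at hz
      calc _ ≤ K / M * (c * (4 * M)) := by
            gcongr
            · exact hχd z
            · exact (g1 z).trans (by gcongr)
        _ = _ := by field_simp
  have b2 : ∀ z, ‖f z‖ * ‖fderiv ℝ (fderiv ℝ χ) z‖ ≤ 16 * c * K := by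
    intro z
    by_cases hz : 4 * M < ‖z‖
    · rw [(hout z hz).2, ContinuousLinearMap.opNorm_zero, mul_zero]; positivity
    · push Not at hz
      calc _ ≤ (c * (4 * M) ^ 2) * (K / M ^ 2) := by
            gcongr
            · exact (g2 z).trans (by gcongr)
            · exact hχdd z
        _ = _ := by field_simp; ring
  have bil : ∀ (B : E →L[ℝ] E →L[ℝ] ℝ) v w, ‖B v w‖ ≤ ‖B‖ * ‖v‖ * ‖w‖ := fun B v w =>
    B.le_opNorm₂ v w
  have err : ∀ z v w, ‖χ z * fderiv ℝ (fderiv ℝ f) z v w + fderiv ℝ χ z v * fderiv ℝ f z w +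
      fderiv ℝ f z v * fderiv ℝ χ z w + f z * fderiv ℝ (fderiv ℝ χ) z v w‖ ≤
      (c + 24 * c * K) * (‖v‖ * ‖w‖) := by
    intro z v w
    have t1 : ‖χ z * fderiv ℝ (fderiv ℝ f) z v w‖ ≤ c * (‖v‖ * ‖w‖) := by
      rw [norm_mul, Real.norm_of_nonneg (hχ0 z)]
      calc _ ≤ 1 * (c * ‖v‖ * ‖w‖) := by
            gcongr
            · exact hχ1 z
            · exact (bil _ _ _).trans (by gcongr; exact hb z)
        _ = _ := by ring
    have t2 : ∀ v w, ‖fderiv ℝ χ z v * fderiv ℝ f z w‖ ≤ 4 * c * K * (‖v‖ * ‖w‖) := by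
      intro v w
      rw [norm_mul]
      calc _ ≤ (‖fderiv ℝ χ z‖ * ‖v‖) * (‖fderiv ℝ f z‖ * ‖w‖) := by
            gcongr <;> exact ContinuousLinearMap.le_opNorm _ _
        _ = (‖fderiv ℝ χ z‖ * ‖fderiv ℝ f z‖) * (‖v‖ * ‖w‖) := by ring
        _ ≤ _ := by gcongr ?_ * (‖v‖ * ‖w‖); exact b1 z
    have t3 : ‖f z * fderiv ℝ (fderiv ℝ χ) z v w‖ ≤ 16 * c * K * (‖v‖ * ‖w‖) := by
      rw [norm_mul]
      calc _ ≤ ‖f z‖ * (‖fderiv ℝ (fderiv ℝ χ) z‖ * ‖v‖ * ‖w‖) := by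
            gcongr; exact bil _ _ _
        _ = (‖f z‖ * ‖fderiv ℝ (fderiv ℝ χ) z‖) * (‖v‖ * ‖w‖) := by ring
        _ ≤ _ := by gcongr ?_ * (‖v‖ * ‖w‖); exact b2 z
    have t4 := t2 w v
    rw [mul_comm (fderiv ℝ χ z w)] at t4
    refine (norm_add₄_le).trans ?_
    have := t2 v w
    linarith
  refine ⟨fun z => ?_, fun z => ?_, fun z v hz => ?_, fun z v hz => ?_⟩
  · have hU : 0 ≤ U := (ContinuousLinearMap.opNorm_nonneg _).trans (hhU 0)
    refine ContinuousLinearMap.opNorm_le_bound₂ _ (by positivity) fun v w => ?_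
    rw [e2]
    refine (norm_add_le _ _).trans ?_
    have t : ‖γ * fderiv ℝ (fderiv ℝ h) z v w‖ ≤ γ * (U * ‖v‖ * ‖w‖) := by
      rw [norm_mul, Real.norm_of_nonneg hγ]
      gcongr
      exact (bil _ _ _).trans (by gcongr; exact hhU z)
    have := err z v w
    linarith
  · rw [e1]
    by_cases hz : 4 * M < ‖z‖
    · rw [(hout z hz).1, hχo z hz.le, hho z (by linarith)]
      simp
      positivity
    · push Not at hz
      have t1 : ‖χ z • fderiv ℝ f z‖ ≤ 4 * c * M := by
        rw [norm_smul, Real.norm_of_nonneg (hχ0 z)]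
        calc _ ≤ 1 * (c * (4 * M)) := by
              gcongr
              · exact hχ1 z
              · exact (g1 z).trans (by gcongr)
          _ = _ := by ring
      have t2 : ‖f z • fderiv ℝ χ z‖ ≤ 16 * c * K * M := by
        rw [norm_smul]
        calc _ ≤ (c * (4 * M) ^ 2) * (K / M) := by
              gcongr
              · exact (g2 z).trans (by gcongr)
              · exact hχd z
          _ = _ := by field_simp; ring
      have t3 : ‖γ • fderiv ℝ h z‖ ≤ γ * (4 * M) := by
        rw [norm_smul, Real.norm_of_nonneg hγ]
        gcongr
        exact (hhd z).trans hz
      have t4 : ‖γ • innerSL ℝ z‖ ≤ γ * (4 * M) := by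
        rw [norm_smul, Real.norm_of_nonneg hγ, innerSL_apply_norm]
        gcongr
      refine (norm_sub_le _ _).trans ?_
      have := norm_add₃_le (a := χ z • fderiv ℝ f z) (b := f z • fderiv ℝ χ z)
        (c := γ • fderiv ℝ h z)
      linarith
  · rw [e2, (hin z hz).1, (hin z hz).2, hχi z hz.le]
    have := mul_nonneg hγ (hh0 z v)
    simp
    linarith
  · rw [e2]
    have h1 := err z v v
    rw [Real.norm_eq_abs] at h1
    have h2 := (abs_le.1 h1).1
    have h3 := mul_le_mul_of_nonneg_left (hh2 z v hz) hγ
    nlinarith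

end helpers

section mat

variable {n : Type*} [Fintype n] [DecidableEq n]

lemma matCLM_sub (A B : Matrix n n ℝ) (v : EuclideanSpace ℝ n) :
    matCLM (A - B) v = matCLM A v - matCLM B v := by
  simp [matCLM]

lemma hess_link {F : EuclideanSpace ℝ n → ℝ} {G : EuclideanSpace ℝ n → EuclideanSpace ℝ n}
    {z : EuclideanSpace ℝ n} {H : Matrix n n ℝ} (hG : ∀ z, HasGradientAt F (G z) z)
    (hH : HasFDerivAt G (matCLM H) z) :
    (∀ v w, fderiv ℝ (fderiv ℝ F) z v w = inner ℝ (matCLM H v) w) ∧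
    ‖fderiv ℝ (fderiv ℝ F) z‖ = ‖matCLM H‖ := by
  let T : EuclideanSpace ℝ n →L[ℝ] (EuclideanSpace ℝ n →L[ℝ] ℝ) := innerSL ℝ
  have e1 : fderiv ℝ F = fun z => T (G z) := funext fun z => (hG z).hasFDerivAt.fderiv
  have e2 : HasFDerivAt (fun z => T (G z)) (T.comp (matCLM H)) z := T.hasFDerivAt.comp z hH
  have e3 : fderiv ℝ (fderiv ℝ F) z = T.comp (matCLM H) := by rw [e1, e2.fderiv]
  have hn : ∀ v, ‖fderiv ℝ (fderiv ℝ F) z v‖ = ‖matCLM H v‖ := fun v => by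
    rw [e3]; exact innerSL_apply_norm (𝕜 := ℝ) (matCLM H v)
  refine ⟨fun v w => by rw [e3]; rfl, le_antisymm ?_ ?_⟩
  · refine ContinuousLinearMap.opNorm_le_bound _ (ContinuousLinearMap.opNorm_nonneg _) fun v => ?_
    rw [hn]; exact ContinuousLinearMap.le_opNorm _ _
  · refine ContinuousLinearMap.opNorm_le_bound _ (ContinuousLinearMap.opNorm_nonneg _) fun v => ?_
    rw [← hn]; exact ContinuousLinearMap.le_opNorm _ _

lemma exists_hess {F : EuclideanSpace ℝ n → ℝ} (hF : ContDiff ℝ 2 F) :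
    ∃ (G : EuclideanSpace ℝ n → EuclideanSpace ℝ n) (H : EuclideanSpace ℝ n → Matrix n n ℝ),
      (∀ z, HasGradientAt F (G z) z) ∧ (∀ z, HasFDerivAt G (matCLM (H z)) z) := by
  let G := fun z => (InnerProductSpace.toDual ℝ (EuclideanSpace ℝ n)).symm (fderiv ℝ F z)
  let T : (EuclideanSpace ℝ n →L[ℝ] ℝ) →L[ℝ] EuclideanSpace ℝ n :=
    (InnerProductSpace.toDual ℝ (EuclideanSpace ℝ n)).symm.toContinuousLinearEquiv.toContinuousLinearMap
  have hG : Differentiable ℝ G :=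
    T.differentiable.comp
      ((fderiv_contDiff_one hF).differentiable (by norm_num))
  refine ⟨G, fun z => Matrix.toEuclideanLin.symm (fderiv ℝ G z).toLinearMap, fun z => ?_,
    fun z => ?_⟩
  · exact hasFDerivAt_iff_hasGradientAt.1 (hF.differentiable (by norm_num) z).hasFDerivAt
  · have : matCLM (Matrix.toEuclideanLin.symm (fderiv ℝ G z).toLinearMap) = fderiv ℝ G z := by
      ext1 v
      simp [matCLM]
    rw [this]
    exact (hG z).hasFDerivAt

lemma posSemidef_iff_matCLM (A : Matrix n n ℝ) : A.PosSemidef ↔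
    (∀ v w, inner ℝ (matCLM A v) w = inner ℝ v (matCLM A w)) ∧
      ∀ v, 0 ≤ inner ℝ (matCLM A v) v := by
  rw [← Matrix.isPositive_toEuclideanLin_iff]
  rfl

lemma symm_inner {A : Matrix n n ℝ} (hA : A.IsSymm) (v w : EuclideanSpace ℝ n) :
    inner ℝ (matCLM A v) w = inner ℝ v (matCLM A w) := by
  have : A.IsHermitian := (Matrix.conjTranspose_eq_transpose_of_trivial A).trans hA
  exact (Matrix.isSymmetric_toEuclideanLin_iff.2 this) v w

lemma posDef_smul_sub {A : Matrix n n ℝ} (hA : A.IsSymm) {γ b : ℝ} (hb : ‖matCLM A‖ ≤ b)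
    (h : b < γ) : (γ • (1 : Matrix n n ℝ) - A).PosDef := by
  refine Matrix.PosDef.of_dotProduct_mulVec_pos ?_ fun x hx => ?_
  · have : A.IsHermitian := (Matrix.conjTranspose_eq_transpose_of_trivial A).trans hA
    refine Matrix.IsHermitian.sub ?_ this
    simp [Matrix.IsHermitian]
  · let v : EuclideanSpace ℝ n := WithLp.toLp 2 x
    have hv : v ≠ 0 := fun h0 => hx (by simpa [v] using h0)
    have e1 : star x ⬝ᵥ ((γ • (1 : Matrix n n ℝ) - A).mulVec x) =
        γ * ‖v‖ ^ 2 - inner ℝ (matCLM A v) v := by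
      rw [Matrix.sub_mulVec, dotProduct_sub, Matrix.smul_mulVec, Matrix.one_mulVec,
        dotProduct_smul]
      congr 1
      rw [← real_inner_self_eq_norm_sq]
      rw [EuclideanSpace.inner_eq_star_dotProduct]; rfl
    rw [e1]
    have h1 : inner ℝ (matCLM A v) v ≤ b * ‖v‖ ^ 2 := by
      refine (real_inner_le_norm _ _).trans ?_
      have := ((matCLM A).le_opNorm v).trans (mul_le_mul_of_nonneg_right hb (norm_nonneg v))
      nlinarith [norm_nonneg v]
    have h2 : 0 < ‖v‖ ^ 2 := by positivity
    nlinarith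

end mat
/-- Truncation lemma: given `R` of class `C²` with `∇_z R(t,0) = 0`, uniformly bounded
Hessian, and Hessian `≥ B_∞(t)` for `|z| > R₀`, there are `γ` with `γI − B_∞(t)` positive
definite, `M_k ↑ ∞` with `M_k > R₀`, and `C²` truncations `R_k` agreeing with `R` on
`{|z| ≤ M_k}`, with uniformly bounded Hessians still `≥ B_∞(t)` for `|z| ≥ R₀`, and with
`|∇_z R_k(t,z) − γ z| ≤ C_k`. Here `G`/`Gk` are the gradients and `Hess`/`Hk` the
Hessians (as matrices) of `R`/`R_k` in `z`. -/
theorem stmt12 (N : ℕ) (hN : 1 ≤ N) (c R₀ : ℝ) (hc : 0 < c) (hR₀ : 0 < R₀)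
    (R : ℝ → EuclideanSpace ℝ (Fin N ⊕ Fin N) → ℝ)
    (G : ℝ → EuclideanSpace ℝ (Fin N ⊕ Fin N) → EuclideanSpace ℝ (Fin N ⊕ Fin N))
    (Hess : ℝ → EuclideanSpace ℝ (Fin N ⊕ Fin N) →
      Matrix (Fin N ⊕ Fin N) (Fin N ⊕ Fin N) ℝ)
    (hR : ContDiff ℝ 2 (uncurry R))
    (hG : ∀ t z, HasGradientAt (R t) (G t z) z)
    (hHess : ∀ t z, HasFDerivAt (G t) (matCLM (Hess t z)) z)
    (hG0 : ∀ t, G t 0 = 0)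
    (hHbound : ∀ t z, ‖matCLM (Hess t z)‖ ≤ c)
    (Binf : ℝ → Matrix (Fin N ⊕ Fin N) (Fin N ⊕ Fin N) ℝ)
    (hBcont : Continuous Binf) (hBsymm : ∀ t, (Binf t).IsSymm)
    (hBbdd : ∃ cB : ℝ, ∀ t, ‖matCLM (Binf t)‖ ≤ cB)
    (hpinch : ∀ t z, R₀ < ‖z‖ → (Hess t z - Binf t).PosSemidef) :
    ∃ γ : ℝ,
      (∀ t, (γ • (1 : Matrix (Fin N ⊕ Fin N) (Fin N ⊕ Fin N) ℝ) - Binf t).PosDef) ∧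
      ∃ M : ℕ → ℝ, StrictMono M ∧ (∀ k, R₀ < M k) ∧ Tendsto M atTop atTop ∧
      ∃ (Rk : ℕ → ℝ → EuclideanSpace ℝ (Fin N ⊕ Fin N) → ℝ)
        (Gk : ℕ → ℝ → EuclideanSpace ℝ (Fin N ⊕ Fin N) →
          EuclideanSpace ℝ (Fin N ⊕ Fin N))
        (Hk : ℕ → ℝ → EuclideanSpace ℝ (Fin N ⊕ Fin N) →
          Matrix (Fin N ⊕ Fin N) (Fin N ⊕ Fin N) ℝ)
        (C : ℝ) (Ck : ℕ → ℝ),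
        0 < C ∧
        ∀ k : ℕ,
          ContDiff ℝ 2 (uncurry (Rk k)) ∧
          (∀ t z, HasGradientAt (Rk k t) (Gk k t z) z) ∧
          (∀ t z, HasFDerivAt (Gk k t) (matCLM (Hk k t z)) z) ∧
          (∀ t z, ‖z‖ ≤ M k → Rk k t z = R t z) ∧
          (∀ t z, ‖matCLM (Hk k t z)‖ ≤ C) ∧
          (∀ t z, R₀ ≤ ‖z‖ → (Hk k t z - Binf t).PosSemidef) ∧
          0 < Ck k ∧
          (∀ t z, ‖Gk k t z - γ • z‖ ≤ Ck k) := by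
  obtain ⟨cB, hcB⟩ := hBbdd
  obtain ⟨K, hK, hcut⟩ := exists_cutoff (E := EuclideanSpace ℝ (Fin N ⊕ Fin N))
  obtain ⟨U, hU, hconv⟩ := exists_convex (E := EuclideanSpace ℝ (Fin N ⊕ Fin N))
  have hcB0 : 0 ≤ cB := (norm_nonneg _).trans (hcB 0)
  let γ : ℝ := c + 24 * c * K + cB + 1
  have hγ : 0 ≤ γ := by positivity
  have hγB : cB < γ := by
    have : 0 ≤ 24 * c * K := by positivity
    show cB < c + 24 * c * K + cB + 1
    linarith
  let M : ℕ → ℝ := fun k => R₀ + 1 + k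
  have hM : ∀ k, 0 < M k := fun k => by positivity
  -- slices
  have hRt : ∀ t, ContDiff ℝ 2 (R t) := fun t =>
    hR.comp (contDiff_const.prodMk contDiff_id)
  let f : ℝ → EuclideanSpace ℝ (Fin N ⊕ Fin N) → ℝ := fun t z => R t z - R t 0
  have hf : ∀ t, ContDiff ℝ 2 (f t) := fun t => (hRt t).sub contDiff_const
  have hfd : ∀ t, fderiv ℝ (f t) = fderiv ℝ (R t) := fun t => by
    ext1 z
    exact fderiv_sub_const _
  have link := fun t z => hess_link (hG t) (hHess t z)
  have hf0 : ∀ t, f t 0 = 0 := fun t => sub_self _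
  have hdf0 : ∀ t, fderiv ℝ (f t) 0 = 0 := fun t => by
    rw [hfd, (hG t 0).hasFDerivAt.fderiv, hG0]
    exact map_zero _
  have hb : ∀ t z, ‖fderiv ℝ (fderiv ℝ (f t)) z‖ ≤ c := fun t z => by
    rw [hfd, (link t z).2]
    exact hHbound t z
  -- the pinching inequality, extended to the closed region
  have pinch1 : ∀ t z v, R₀ < ‖z‖ →
      inner ℝ (matCLM (Binf t) v) v ≤ fderiv ℝ (fderiv ℝ (f t)) z v v := by
    intro t z v hz
    have := ((posSemidef_iff_matCLM _).1 (hpinch t z hz)).2 v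
    rw [matCLM_sub, inner_sub_left] at this
    rw [hfd, (link t z).1]
    linarith
  have pinch2 : ∀ t z v, R₀ ≤ ‖z‖ →
      inner ℝ (matCLM (Binf t) v) v ≤ fderiv ℝ (fderiv ℝ (f t)) z v v := by
    intro t z v hz
    have hcont : Continuous fun s : ℝ => fderiv ℝ (fderiv ℝ (f t)) (s • z) v v := by
      have h1 : Continuous (fderiv ℝ (fderiv ℝ (f t))) :=
        (fderiv_contDiff_one (hf t)).continuous_fderiv (by norm_num)
      have h2 : Continuous fun s : ℝ => fderiv ℝ (fderiv ℝ (f t)) (s • z) :=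
        h1.comp (continuous_id.smul continuous_const)
      exact (h2.clm_apply continuous_const).clm_apply continuous_const
    have hlim := (hcont.tendsto 1).mono_left (nhdsWithin_le_nhds (s := Set.Ioi 1))
    simp only [one_smul] at hlim
    refine ge_of_tendsto hlim ?_
    filter_upwards [self_mem_nhdsWithin] with s hs
    apply pinch1
    have hs1 : (1 : ℝ) < s := hs
    rw [norm_smul, Real.norm_of_nonneg (by linarith)]
    nlinarith
  choose χ hχ hχ0 hχ1 hχi hχo hχd hχdd using fun k => hcut (M k) (hM k)
  choose h hh hhi hhd hho hh0 hh2 hhU using fun k => hconv (M k) (hM k)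
  let Rk : ℕ → ℝ → EuclideanSpace ℝ (Fin N ⊕ Fin N) → ℝ := fun k t z =>
    R t 0 + χ k z * f t z + γ * h k z
  have hRk : ∀ k t, ContDiff ℝ 2 (Rk k t) := fun k t =>
    (contDiff_const.add ((hχ k).mul (hf t))).add (contDiff_const.mul (hh k))
  choose Gk Hk hGk hHk using fun k t => exists_hess (hRk k t)
  have linkk := fun k t z => hess_link (hGk k t) (hHk k t z)
  have main := fun k t => core (hχ k) (hf t) (hh k) (R t 0) γ hγ (hM k) hK (hf0 t) (hdf0 t) (hb t)
    (hχ0 k) (hχ1 k) (hχi k) (hχo k) (hχd k) (hχdd k) (hhd k) (hho k) (hh0 k) (hh2 k) (hhU k)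
  refine ⟨γ, fun t => posDef_smul_sub (hBsymm t) (hcB t) hγB, M, ?_, ?_, ?_, Rk, Gk, Hk,
    c + 24 * c * K + γ * U,
    fun k => 4 * c * M k + 16 * c * K * M k + 8 * γ * M k, by positivity, fun k => ?_⟩
  · intro i j hij
    have : (i : ℝ) < j := by exact_mod_cast hij
    show R₀ + 1 + (i : ℝ) < R₀ + 1 + j
    linarith
  · intro k
    have : (0 : ℝ) ≤ k := k.cast_nonneg
    show R₀ < R₀ + 1 + (k : ℝ)
    linarith
  · exact tendsto_atTop_add_const_left _ _ tendsto_natCast_atTop_atTop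
  have hMk := hM k
  refine ⟨?_, hGk k, hHk k, ?_, ?_, ?_, by positivity, ?_⟩
  · have h0 : ContDiff ℝ 2 fun p : ℝ × EuclideanSpace ℝ (Fin N ⊕ Fin N) => R p.1 0 :=
      hR.comp (contDiff_fst.prodMk contDiff_const)
    exact (h0.add (((hχ k).comp contDiff_snd).mul (hR.sub h0))).add
      (contDiff_const.mul ((hh k).comp contDiff_snd))
  · intro t z hz
    show R t 0 + χ k z * (R t z - R t 0) + γ * h k z = R t z
    rw [hχi k z (by linarith), hhi k z hz]
    ring
  · intro t z
    rw [← (linkk k t z).2]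
    exact (main k t).1 z
  · intro t z hz
    refine (posSemidef_iff_matCLM _).2 ⟨fun v w => ?_, fun v => ?_⟩
    · rw [matCLM_sub, matCLM_sub, inner_sub_left, inner_sub_right, symm_inner (hBsymm t)]
      congr 1
      rw [← (linkk k t z).1, real_inner_comm, ← (linkk k t z).1]
      have hs : IsSymmSndFDerivAt ℝ (Rk k t) z :=
        (hRk k t).contDiffAt.isSymmSndFDerivAt (by simp)
      exact hs v w
    · rw [matCLM_sub, inner_sub_left, ← (linkk k t z).1, sub_nonneg]
      by_cases hz2 : ‖z‖ < 2 * M k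
      · exact (pinch2 t z v hz).trans ((main k t).2.2.1 z v hz2)
      · refine le_trans ?_ ((main k t).2.2.2 z v (not_lt.1 hz2))
        refine (real_inner_le_norm _ _).trans ?_
        have h1 := ((matCLM (Binf t)).le_opNorm v).trans
          (mul_le_mul_of_nonneg_right (hcB t) (norm_nonneg v))
        have h2 : γ - c - 24 * c * K = cB + 1 := by
          show c + 24 * c * K + cB + 1 - c - 24 * c * K = cB + 1
          ring
        rw [h2]
        nlinarith [norm_nonneg v, sq_nonneg ‖v‖]
  · intro t z
    have h1 := (main k t).2.1 z
    have h2 : fderiv ℝ (Rk k t) z - γ • innerSL ℝ z = innerSL ℝ (Gk k t z - γ • z) := by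
      rw [(hGk k t z).hasFDerivAt.fderiv]
      ext w
      simp [inner_sub_left, inner_smul_left]
    rw [← innerSL_apply_norm (𝕜 := ℝ), ← h2]
    exact h1
end

section
/- Let α > 0 and define L : ℝ → M₂(ℝ) by L(t) = |t|^α [[cos 2t, sin 2t], [sin 2t, −cos 2t]]. Then there exist no constant matrix P ∈ M₂(ℝ), no c > 0 and no t₀ ≥ 0 such that P L(t) − c |t|^α I₂ is positive semidefinite for all t with |t| ≥ t₀. -/
open Matrix Real

/-- For `L(t) = |t|^α [[cos 2t, sin 2t], [sin 2t, −cos 2t]]` there is no constant matrix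
`P`, `c > 0` and `t₀ ≥ 0` such that `P L(t) − c |t|^α I₂` is positive semidefinite
(in the sense `⟨Mξ, ξ⟩ ≥ 0` for all `ξ`) for all `|t| ≥ t₀`. -/
theorem stmt15 (α : ℝ) (hα : 0 < α) :
    ¬ ∃ (P : Matrix (Fin 2) (Fin 2) ℝ) (c t₀ : ℝ), 0 < c ∧ 0 ≤ t₀ ∧
      ∀ t : ℝ, t₀ ≤ |t| → ∀ ξ : Fin 2 → ℝ,
        0 ≤ ((P * (|t| ^ α •
              !![Real.cos (2 * t), Real.sin (2 * t);
                 Real.sin (2 * t), -Real.cos (2 * t)]) -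
            (c * |t| ^ α) • (1 : Matrix (Fin 2) (Fin 2) ℝ)).mulVec ξ) ⬝ᵥ ξ := by
  rintro ⟨P, c, t₀, hc, ht₀, h⟩
  obtain ⟨n, hn⟩ := exists_nat_gt t₀
  have hnpos : (0 : ℝ) < n := lt_of_le_of_lt ht₀ hn
  have hpi : (3 : ℝ) < π := Real.pi_gt_three
  have hnp : (n : ℝ) ≤ n * π := by nlinarith
  -- the quadratic form at the first basis vector, for times with `sin (2 t) = 0`
  have key : ∀ t e : ℝ, (n : ℝ) ≤ t → Real.cos (2 * t) = e → Real.sin (2 * t) = 0 →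
      0 ≤ P 0 0 * e - c := by
    intro t e htn hcos hsin
    have htpos : 0 < t := lt_of_lt_of_le hnpos htn
    have habs : |t| = t := abs_of_pos htpos
    have h1 := h t (by rw [habs]; linarith) ![1, 0]
    rw [habs, hcos, hsin] at h1
    have hp : 0 < t ^ α := Real.rpow_pos_of_pos htpos α
    simp [Matrix.mulVec, dotProduct, Fin.sum_univ_two, Matrix.mul_apply] at h1
    have h2 : 0 ≤ t ^ α * (P 0 0 * e - c) := by linarith
    exact nonneg_of_mul_nonneg_right h2 hp
  have c1 : Real.cos (2 * (n * π)) = 1 := by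
    rw [show 2 * ((n : ℝ) * π) = n * (2 * π) by ring]
    exact Real.cos_nat_mul_two_pi n
  have s1 : Real.sin (2 * (n * π)) = 0 := by
    rw [show 2 * ((n : ℝ) * π) = ((2 * n : ℕ) : ℝ) * π by push_cast; ring]
    exact Real.sin_nat_mul_pi _
  have e2 : 2 * ((n : ℝ) * π + π / 2) = 2 * (n * π) + π := by ring
  have k1 := key (n * π) 1 hnp c1 s1
  have k2 := key (n * π + π / 2) (-1) (by linarith)
    (by rw [e2, Real.cos_add_pi, c1]) (by rw [e2, Real.sin_add_pi, s1, neg_zero])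
  linarith
end
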